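/- Let G be the series composition of multigraphs G1 and G2 at a vertex x, let a, s ∈ V1 \ {x} be distinct, let t, b ∈ V2 \ {x} be distinct, and let r_a, r_s, r_t, r_b ∈ ℤ with r_a + r_s + r_t + r_b = 0. Then mincost(G, [a ↦ r_a, s ↦ r_s, t ↦ r_t, b ↦ r_b]) = mincost(G1, [a ↦ r_a, s ↦ r_s, x ↦ −r_a − r_s]) + mincost(G2, [x ↦ r_a + r_s, t ↦ r_t, b ↦ r_b]), where the addition is in ℕ∞. -/

import Mathlib

open scoped BigOperators

/-- An undirected multigraph on vertex type `V` with edge type `E`: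
each edge has a reference orientation `src e → tgt e`, a cost `c e` and a capacity `u e`. -/
structure Multigraph (V E : Type) where
  src : E → V
  tgt : E → V
  c : E → ℕ
  u : E → ℕ

variable {V E : Type}

/-- The residue of a flow assignment `f : E → ℤ` at a vertex `v`:
inflow (w.r.t. the reference orientation) minus outflow. -/
def Multigraph.residue [Fintype E] [DecidableEq V] (G : Multigraph V E)
    (f : E → ℤ) (v : V) : ℤ :=
  (∑ e : E, if G.tgt e = v then f e else 0) - (∑ e : E, if G.src e = v then f e else 0)

/-- `f` is an `r`-circulation supported on `F`: it vanishes outside `F`,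
respects capacities, and has residue `r v` at every vertex `v`. -/
def Multigraph.IsCirculation [Fintype E] [DecidableEq V] (G : Multigraph V E)
    (r : V → ℤ) (F : Finset E) (f : E → ℤ) : Prop :=
  (∀ e, e ∉ F → f e = 0) ∧ (∀ e, |f e| ≤ (G.u e : ℤ)) ∧ (∀ v, G.residue f v = r v)

/-- The minimum cost (in `ℕ∞`) of a subset `F` of the allowed edge set `E'`
admitting an `r`-circulation supported on `F`.  Taking `E' = Finset.univ`
gives `mincost(G, r)`; taking `E' = E₁` for a sub-multigraph `(V₁, E₁)` all of
whose edges have both endpoints in `V₁` gives `mincost(G₁, r)` whenever `r`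
vanishes outside `V₁`. -/
noncomputable def Multigraph.mincostOn [Fintype E] [DecidableEq V] (G : Multigraph V E)
    (E' : Finset E) (r : V → ℤ) : ℕ∞ :=
  ⨅ (F : Finset E) (_ : F ⊆ E' ∧ ∃ f : E → ℤ, G.IsCirculation r F f),
    ((∑ e ∈ F, G.c e : ℕ) : ℕ∞)

namespace Multigraph

section

variable [Fintype E] [DecidableEq V] (G : Multigraph V E)

lemma residue_add (f g : E → ℤ) (v : V) :
    G.residue (f + g) v = G.residue f v + G.residue g v := by
  have h : ∀ (p : E → Prop) [DecidablePred p], (∑ e, if p e then (f + g) e else 0) =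
      (∑ e, if p e then f e else 0) + ∑ e, if p e then g e else 0 := by
    intro p _
    rw [← Finset.sum_add_distrib]
    refine Finset.sum_congr rfl fun e _ => ?_
    split_ifs <;> simp
  simp only [residue, h]
  ring

lemma sum_residue [Fintype V] (f : E → ℤ) : ∑ v, G.residue f v = 0 := by
  simp only [residue, Finset.sum_sub_distrib]
  rw [Finset.sum_comm, Finset.sum_comm (f := fun v e => if G.src e = v then f e else 0)]
  simp

/-- A flow vanishing on every edge incident to `v` has residue zero at `v`. -/
lemma residue_eq_zero {f : E → ℤ} {v : V}
    (h : ∀ e, G.src e = v ∨ G.tgt e = v → f e = 0) : G.residue f v = 0 := by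
  rw [residue, Finset.sum_eq_zero, Finset.sum_eq_zero, sub_zero]
  · intro e _
    split_ifs with he
    exacts [h e (.inl he), rfl]
  · intro e _
    split_ifs with he
    exacts [h e (.inr he), rfl]

lemma mincostOn_le {E' F : Finset E} {r : V → ℤ} {f : E → ℤ}
    (hF : F ⊆ E') (hf : G.IsCirculation r F f) :
    G.mincostOn E' r ≤ ((∑ e ∈ F, G.c e : ℕ) : ℕ∞) :=
  iInf₂_le F ⟨hF, f, hf⟩

/-- A finite minimum cost is attained. -/
lemma mincostOn_eq_top_or_attained (E' : Finset E) (r : V → ℤ) :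
    G.mincostOn E' r = ⊤ ∨ ∃ F ⊆ E', ∃ f, G.IsCirculation r F f ∧
      G.mincostOn E' r = ((∑ e ∈ F, G.c e : ℕ) : ℕ∞) := by
  unfold mincostOn
  rw [iInf_subtype']
  cases isEmpty_or_nonempty {F : Finset E // F ⊆ E' ∧ ∃ f, G.IsCirculation r F f} with
  | inl h => exact .inl (iInf_of_empty _)
  | inr h =>
    obtain ⟨⟨F, hF, f, hf⟩, h⟩ := exists_eq_ciInf_of_finite
      (f := fun F : {F : Finset E // F ⊆ E' ∧ ∃ f, G.IsCirculation r F f} =>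
        ((∑ e ∈ F.1, G.c e : ℕ) : ℕ∞))
    exact .inr ⟨F, hF, f, hf, h.symm⟩

variable {G} [DecidableEq E]

/-- Circulations on disjoint supports add up. -/
lemma IsCirculation.add {r₁ r₂ : V → ℤ} {F₁ F₂ : Finset E} {f₁ f₂ : E → ℤ}
    (hF : Disjoint F₁ F₂) (h₁ : G.IsCirculation r₁ F₁ f₁) (h₂ : G.IsCirculation r₂ F₂ f₂) :
    G.IsCirculation (r₁ + r₂) (F₁ ∪ F₂) (f₁ + f₂) := by
  refine ⟨fun e he => ?_, fun e => ?_, fun v => ?_⟩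
  · rw [Finset.notMem_union] at he
    simp [h₁.1 e he.1, h₂.1 e he.2]
  · by_cases he : e ∈ F₁
    · simpa [h₂.1 e (Finset.disjoint_left.mp hF he)] using h₁.2.1 e
    · simpa [h₁.1 e he] using h₂.2.1 e
  · rw [residue_add, h₁.2.2, h₂.2.2, Pi.add_apply]

/-- In a series composition at `x`, a circulation restricts to a circulation on one side, provided
the residue function splits into parts supported on the two sides. -/
lemma IsCirculation.restrict [Fintype V] {V₁ V₂ : Finset V} {E₁ E₂ : Finset E} {x : V}
    (hE : E₁ ∪ E₂ = Finset.univ) (hEdisj : Disjoint E₁ E₂) (hVx : V₁ ∩ V₂ = {x})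
    (hG₁ : ∀ e ∈ E₁, G.src e ∈ V₁ ∧ G.tgt e ∈ V₁) (hG₂ : ∀ e ∈ E₂, G.src e ∈ V₂ ∧ G.tgt e ∈ V₂)
    {r₁ r₂ : V → ℤ} (hr₁ : ∀ v ∉ V₁, r₁ v = 0) (hr₂ : ∀ v ∉ V₂, r₂ v = 0)
    (hsum : ∑ v, r₁ v = 0) {F : Finset E} {f : E → ℤ} (hf : G.IsCirculation (r₁ + r₂) F f) :
    G.IsCirculation r₁ (F ∩ E₁) (fun e => if e ∈ E₁ then f e else 0) := by
  set f₁ : E → ℤ := fun e => if e ∈ E₁ then f e else 0 with hf₁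
  set f₂ : E → ℤ := fun e => if e ∈ E₂ then f e else 0 with hf₂
  have hadd : f = f₁ + f₂ := by
    funext e
    have h : e ∈ E₁ ∪ E₂ := hE ▸ Finset.mem_univ e
    by_cases he : e ∈ E₁
    · simp [hf₁, hf₂, he, Finset.disjoint_left.mp hEdisj he]
    · simp [hf₁, hf₂, he, (Finset.mem_union.mp h).resolve_left he]
  have hne : ∀ v, v ≠ x → G.residue f₁ v = r₁ v := by
    intro v hv
    by_cases h₁ : v ∈ V₁
    · have h₂ : v ∉ V₂ := fun h₂ =>
        hv (Finset.mem_singleton.mp (hVx ▸ Finset.mem_inter.mpr ⟨h₁, h₂⟩))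
      have hz : G.residue f₂ v = 0 := by
        refine G.residue_eq_zero fun e he => if_neg fun h => h₂ ?_
        rcases he with rfl | rfl
        exacts [(hG₂ e h).1, (hG₂ e h).2]
      have h := hf.2.2 v
      rwa [hadd, residue_add, hz, Pi.add_apply, hr₂ v h₂, add_zero, add_zero] at h
    · rw [hr₁ v h₁]
      refine G.residue_eq_zero fun e he => if_neg fun h => h₁ ?_
      rcases he with rfl | rfl
      exacts [(hG₁ e h).1, (hG₁ e h).2]
  refine ⟨fun e he => ?_, fun e => ?_, fun v => ?_⟩
  · by_cases h : e ∈ E₁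
    · simp only [hf₁, if_pos h]
      exact hf.1 e fun hF => he (Finset.mem_inter.mpr ⟨hF, h⟩)
    · exact if_neg h
  · by_cases h : e ∈ E₁
    · simpa [hf₁, h] using hf.2.1 e
    · simp [hf₁, h]
  · by_cases hv : v = x
    · subst hv
      have h := (G.sum_residue f₁).trans hsum.symm
      rw [← Finset.add_sum_erase _ _ (Finset.mem_univ v),
        ← Finset.add_sum_erase _ r₁ (Finset.mem_univ v),
        Finset.sum_congr rfl fun w hw => hne w (Finset.ne_of_mem_erase hw)] at h
      exact add_right_cancel h
    · exact hne v hv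

/-- The minimum cost of a series composition is the sum of the minimum costs of its two parts, for
balanced residue functions supported on the respective sides. -/
theorem mincostOn_series [Fintype V] {V₁ V₂ : Finset V} {E₁ E₂ : Finset E} {x : V}
    (hE : E₁ ∪ E₂ = Finset.univ) (hEdisj : Disjoint E₁ E₂) (hVx : V₁ ∩ V₂ = {x})
    (hG₁ : ∀ e ∈ E₁, G.src e ∈ V₁ ∧ G.tgt e ∈ V₁) (hG₂ : ∀ e ∈ E₂, G.src e ∈ V₂ ∧ G.tgt e ∈ V₂)
    {r₁ r₂ : V → ℤ} (hr₁ : ∀ v ∉ V₁, r₁ v = 0) (hr₂ : ∀ v ∉ V₂, r₂ v = 0)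
    (hsum₁ : ∑ v, r₁ v = 0) (hsum₂ : ∑ v, r₂ v = 0) :
    G.mincostOn Finset.univ (r₁ + r₂) = G.mincostOn E₁ r₁ + G.mincostOn E₂ r₂ := by
  apply le_antisymm
  · obtain h₁ | ⟨F₁, hF₁, f₁, hf₁, h₁⟩ := G.mincostOn_eq_top_or_attained E₁ r₁
    · simp [h₁]
    obtain h₂ | ⟨F₂, hF₂, f₂, hf₂, h₂⟩ := G.mincostOn_eq_top_or_attained E₂ r₂
    · simp [h₂]
    have hF : Disjoint F₁ F₂ := hEdisj.mono hF₁ hF₂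
    rw [h₁, h₂, ← Nat.cast_add, ← Finset.sum_union hF]
    exact G.mincostOn_le (Finset.subset_univ _) (hf₁.add hF hf₂)
  · refine le_iInf₂ fun F ⟨_, f, hf⟩ => ?_
    have hf₁ := hf.restrict hE hEdisj hVx hG₁ hG₂ hr₁ hr₂ hsum₁
    rw [add_comm] at hf
    have hf₂ := hf.restrict (Finset.union_comm E₂ E₁ ▸ hE) hEdisj.symm
      (Finset.inter_comm V₂ V₁ ▸ hVx) hG₂ hG₁ hr₂ hr₁ hsum₂
    have hF : F = F ∩ E₁ ∪ F ∩ E₂ := by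
      rw [← Finset.inter_union_distrib_left, hE, Finset.inter_univ]
    rw [hF, Finset.sum_union (hEdisj.mono Finset.inter_subset_right Finset.inter_subset_right),
      Nat.cast_add]
    exact add_le_add (G.mincostOn_le Finset.inter_subset_right hf₁)
      (G.mincostOn_le Finset.inter_subset_right hf₂)

end

end Multigraph

/-- The sum of a function prescribed at three distinct points and zero elsewhere. -/
lemma Fintype.sum_ite_eq_three [Fintype V] [DecidableEq V] {p q w : V} (hpq : p ≠ q) (hpw : p ≠ w)
    (hqw : q ≠ w) (α β γ : ℤ) :
    (∑ v, if v = p then α else if v = q then β else if v = w then γ else 0) = α + β + γ := by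
  have h : ∀ v, (if v = p then α else if v = q then β else if v = w then γ else 0) =
      (if v = p then α else 0) + (if v = q then β else 0) + (if v = w then γ else 0) := by
    intro v
    grind
  simp [h, Finset.sum_add_distrib]

/-- Case 3.2: series composition splitting `s` and `t` into different subgraphs. -/
theorem series_four_tuple_split_s_t {V E : Type}
    [Fintype V] [Fintype E] [DecidableEq V] [DecidableEq E]
    (G : Multigraph V E) (V1 V2 : Finset V) (E1 E2 : Finset E)
    (hE : E1 ∪ E2 = Finset.univ) (hEdisj : Disjoint E1 E2)
    (hV : V1 ∪ V2 = Finset.univ)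
    (hG1 : ∀ e ∈ E1, G.src e ∈ V1 ∧ G.tgt e ∈ V1)
    (hG2 : ∀ e ∈ E2, G.src e ∈ V2 ∧ G.tgt e ∈ V2)
    (x a s t b : V) (hVx : V1 ∩ V2 = {x})
    (ha : a ∈ V1) (hax : a ≠ x) (hs : s ∈ V1) (hsx : s ≠ x) (has : a ≠ s)
    (ht : t ∈ V2) (htx : t ≠ x) (hb : b ∈ V2) (hbx : b ≠ x) (htb : t ≠ b)
    (ra rs rt rb : ℤ) (hsum : ra + rs + rt + rb = 0) :
    G.mincostOn Finset.univ
        (fun v => if v = a then ra else if v = s then rs else if v = t then rt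
          else if v = b then rb else 0) =
      G.mincostOn E1
        (fun v => if v = a then ra else if v = s then rs else if v = x then -ra - rs else 0) +
      G.mincostOn E2
        (fun v => if v = x then ra + rs else if v = t then rt else if v = b then rb else 0) := by
  have hmem : ∀ v, v ∈ V1 → v ∈ V2 → v = x := fun v h₁ h₂ =>
    Finset.mem_singleton.mp (hVx ▸ Finset.mem_inter.mpr ⟨h₁, h₂⟩)
  have hx : x ∈ V1 ∩ V2 := hVx ▸ Finset.mem_singleton_self x
  obtain ⟨hx₁, hx₂⟩ := Finset.mem_inter.mp hx
  have hat : a ≠ t := fun h => hax (hmem a ha (h ▸ ht))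
  have hab : a ≠ b := fun h => hax (hmem a ha (h ▸ hb))
  have hst : s ≠ t := fun h => hsx (hmem s hs (h ▸ ht))
  have hsb : s ≠ b := fun h => hsx (hmem s hs (h ▸ hb))
  rw [← Multigraph.mincostOn_series hE hEdisj hVx hG1 hG2]
  · congr 1
    funext v
    simp only [Pi.add_apply]
    grind
  · intro v hv
    grind
  · intro v hv
    grind
  · rw [Fintype.sum_ite_eq_three has hax hsx]
    ring
  · rw [Fintype.sum_ite_eq_three htx.symm hbx.symm htb]
    linarith
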